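/- For α ∈ [0,1), t > 0 and z ∈ ℝⁿ, the fractional Laplacian (in the z-variable) of the Poisson kernel satisfies |(−Δ)^{α/2} p_t(z)| ≲ (t² + |z|²)^{−(n+α)/2}, with implicit constant independent of t and z. -/

import Mathlib

open MeasureTheory

/-- The Poisson kernel `p_t(z) = t/(t²+|z|²)^{(n+1)/2}` on `ℝ^{n+1}_+`. -/
noncomputable def poissonKer (n : ℕ) (t : ℝ) (z : EuclideanSpace ℝ (Fin n)) : ℝ :=
  t / (t ^ 2 + ‖z‖ ^ 2) ^ (((n : ℝ) + 1) / 2)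

/-- The fractional Laplacian `(-Δ)^{α/2}` on `ℝⁿ`, via its singular integral representation. -/
noncomputable def fracLap {n : ℕ} (α : ℝ) (f : EuclideanSpace ℝ (Fin n) → ℝ)
    (x : EuclideanSpace ℝ (Fin n)) : ℝ :=
  ∫ y, (f x - f y) / ‖x - y‖ ^ ((n : ℝ) + α)

lemma poissonKer_pos {n : ℕ} {t : ℝ} (ht : 0 < t) (z : EuclideanSpace ℝ (Fin n)) :
    0 < poissonKer n t z := by
  unfold poissonKer
  positivity

lemma poissonKer_mul_smul {n : ℕ} {R : ℝ} (hR : 0 < R) {s : ℝ} (hs : 0 < s)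
    (x : EuclideanSpace ℝ (Fin n)) :
    poissonKer n (R * s) (R • x) = (R ^ n)⁻¹ * poissonKer n s x := by
  unfold poissonKer
  have h1 : (R * s) ^ 2 + ‖R • x‖ ^ 2 = R ^ 2 * (s ^ 2 + ‖x‖ ^ 2) := by
    rw [norm_smul, Real.norm_of_nonneg hR.le]; ring
  have h2 : (R ^ 2) ^ (((n : ℝ) + 1) / 2) = R ^ n * R := by
    rw [← Real.rpow_natCast R 2, ← Real.rpow_mul hR.le,
      show ((2 : ℕ) : ℝ) * (((n : ℝ) + 1) / 2) = ((n + 1 : ℕ) : ℝ) by push_cast; ring,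
      Real.rpow_natCast, pow_succ]
  have h3 : 0 < (s ^ 2 + ‖x‖ ^ 2) ^ (((n : ℝ) + 1) / 2) := by positivity
  rw [h1, Real.mul_rpow (by positivity) (by positivity), h2]
  field_simp

lemma integrable_poissonKer_one (n : ℕ) : Integrable (poissonKer n 1) := by
  have h := integrable_rpow_neg_one_add_norm_sq (E := EuclideanSpace ℝ (Fin n)) (μ := volume)
    (r := (n : ℝ) + 1) (by simp)
  refine h.congr (ae_of_all _ fun x => ?_)
  simp only [poissonKer, one_pow, one_div]
  rw [← Real.rpow_neg (by positivity)]
  congr 1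
  ring

lemma poissonKer_eq_dilation {n : ℕ} {s : ℝ} (hs : 0 < s) :
    poissonKer n s = fun x => (s ^ n)⁻¹ * poissonKer n 1 (s⁻¹ • x) := by
  funext x
  rw [← poissonKer_mul_smul hs one_pos, smul_inv_smul₀ hs.ne', mul_one]

lemma integrable_poissonKer {n : ℕ} {s : ℝ} (hs : 0 < s) : Integrable (poissonKer n s) := by
  rw [poissonKer_eq_dilation hs]
  exact ((integrable_poissonKer_one n).comp_smul (inv_ne_zero hs.ne')).const_mul _

lemma integral_poissonKer {n : ℕ} {s : ℝ} (hs : 0 < s) :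
    ∫ x, poissonKer n s x = ∫ x, poissonKer n 1 x := by
  rw [poissonKer_eq_dilation hs, integral_const_mul,
    Measure.integral_comp_inv_smul_of_nonneg _ _ hs.le]
  simp only [finrank_euclideanSpace, Fintype.card_fin, smul_eq_mul]
  field_simp

lemma fracLap_poissonKer_mul_smul {n : ℕ} (α : ℝ) {R : ℝ} (hR : 0 < R) {s : ℝ} (hs : 0 < s)
    (x : EuclideanSpace ℝ (Fin n)) :
    fracLap α (poissonKer n (R * s)) (R • x) =
      R ^ (-((n : ℝ) + α)) * fracLap α (poissonKer n s) x := by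
  unfold fracLap
  have h := Measure.integral_comp_smul_of_nonneg (volume : Measure (EuclideanSpace ℝ (Fin n)))
    (fun y => (poissonKer n (R * s) (R • x) - poissonKer n (R * s) y) /
      ‖R • x - y‖ ^ ((n : ℝ) + α)) R (hR := hR.le)
  simp only [finrank_euclideanSpace, Fintype.card_fin, smul_eq_mul] at h
  rw [inv_mul_eq_div, eq_div_iff (by positivity)] at h
  rw [← h, ← integral_const_mul, ← integral_mul_const]
  refine integral_congr_ae (ae_of_all _ fun y => ?_)
  simp only
  rw [poissonKer_mul_smul hR hs, poissonKer_mul_smul hR hs, ← smul_sub, norm_smul,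
    Real.norm_of_nonneg hR.le, Real.mul_rpow hR.le (norm_nonneg _), Real.rpow_neg hR.le]
  field_simp

lemma abs_one_sub_rpow_neg_le {m : ℝ} (hm : 0 ≤ m) {q : ℝ} (hq : 1 / 4 ≤ q) :
    |1 - q ^ (-m)| ≤ m * (1 / 4) ^ (-m - 1) * |1 - q| := by
  have h := (convex_Ici (1 / 4 : ℝ)).norm_image_sub_le_of_norm_hasDerivWithin_le
    (f := fun q : ℝ => q ^ (-m)) (f' := fun q => -m * q ^ (-m - 1))
    (C := m * (1 / 4) ^ (-m - 1)) (x := q) (y := 1)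
    (fun x hx => (Real.hasDerivAt_rpow_const
      (Or.inl (by simp only [Set.mem_Ici] at hx; linarith))).hasDerivWithinAt)
    (fun x hx => by
      simp only [Set.mem_Ici] at hx
      have hx0 : 0 < x := by linarith
      rw [norm_mul, norm_neg, Real.norm_of_nonneg hm, Real.norm_of_nonneg (by positivity)]
      exact mul_le_mul_of_nonneg_left
        (Real.rpow_le_rpow_of_nonpos (by norm_num) hx (by linarith)) hm)
    (by simpa using hq) (by norm_num)
  simpa using h

lemma abs_poissonKer_sub_le {n : ℕ} {s : ℝ} (hs : 0 < s) {w : EuclideanSpace ℝ (Fin n)}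
    (hw : s ^ 2 + ‖w‖ ^ 2 = 1) {y : EuclideanSpace ℝ (Fin n)} (hy : ‖w - y‖ < 1 / 2) :
    |poissonKer n s w - poissonKer n s y| ≤
      3 * ((((n : ℝ) + 1) / 2) * (1 / 4) ^ (-(((n : ℝ) + 1) / 2) - 1)) * ‖w - y‖ := by
  have hs1 : s ≤ 1 := by nlinarith [sq_nonneg ‖w‖]
  have hw1 : ‖w‖ ≤ 1 := by nlinarith [sq_nonneg s]
  have hsub : |‖w‖ - ‖y‖| ≤ ‖w - y‖ := abs_norm_sub_norm_le w y
  obtain ⟨h1, h2⟩ := abs_le.mp hsub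
  have hq : 1 / 4 ≤ s ^ 2 + ‖y‖ ^ 2 := by
    rcases le_total ‖w‖ (1 / 2) with h | h
    · nlinarith [sq_nonneg ‖y‖, norm_nonneg w]
    · nlinarith [norm_nonneg y]
  have hdiff : |1 - (s ^ 2 + ‖y‖ ^ 2)| ≤ 3 * ‖w - y‖ := by
    rw [show 1 - (s ^ 2 + ‖y‖ ^ 2) = (‖w‖ - ‖y‖) * (‖w‖ + ‖y‖) by rw [← hw]; ring, abs_mul,
      abs_of_nonneg (by positivity : 0 ≤ ‖w‖ + ‖y‖), mul_comm]
    exact mul_le_mul (by linarith) hsub (abs_nonneg _) (by norm_num)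
  have hm : (0 : ℝ) ≤ ((n : ℝ) + 1) / 2 := by positivity
  have key := abs_one_sub_rpow_neg_le hm hq
  have e : poissonKer n s w - poissonKer n s y =
      s * (1 - (s ^ 2 + ‖y‖ ^ 2) ^ (-(((n : ℝ) + 1) / 2))) := by
    unfold poissonKer
    rw [hw, Real.one_rpow, Real.rpow_neg (by positivity)]
    ring
  rw [e, abs_mul, abs_of_pos hs]
  calc s * |1 - (s ^ 2 + ‖y‖ ^ 2) ^ (-(((n : ℝ) + 1) / 2))|
      ≤ 1 * |1 - (s ^ 2 + ‖y‖ ^ 2) ^ (-(((n : ℝ) + 1) / 2))| := by gcongr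
    _ ≤ _ := by
      rw [one_mul]
      refine key.trans ((mul_le_mul_of_nonneg_left hdiff (by positivity)).trans_eq (by ring))

/-- A radial majorant of `min (|u|, 1) / |u| ^ (n + α)`, as a function of `r = |u|`. -/
noncomputable def radialMajorant (n : ℕ) (α r : ℝ) : ℝ :=
  if r < 1 / 2 then r / r ^ ((n : ℝ) + α) else 1 / r ^ ((n : ℝ) + α)

lemma radialMajorant_nonneg (n : ℕ) (α : ℝ) {r : ℝ} (hr : 0 ≤ r) : 0 ≤ radialMajorant n α r := by
  unfold radialMajorant
  split_ifs <;> positivity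

lemma pow_sub_one_mul_rpow_neg {n : ℕ} (hn : 0 < n) {r : ℝ} (hr : 0 < r) (α : ℝ) :
    r ^ (n - 1) * (1 / r ^ ((n : ℝ) + α)) = r ^ (-1 - α) := by
  rw [one_div, ← Real.rpow_neg hr.le, ← Real.rpow_natCast, ← Real.rpow_add hr, Nat.cast_sub hn]
  congr 1
  push_cast
  ring

lemma integrable_radialMajorant_norm {n : ℕ} (hn : 0 < n) {α : ℝ} (h0 : 0 < α) (h1 : α < 1) :
    Integrable (fun u : EuclideanSpace ℝ (Fin n) => radialMajorant n α ‖u‖) := by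
  have : Nonempty (Fin n) := ⟨⟨0, hn⟩⟩
  rw [integrable_fun_norm_addHaar volume (f := radialMajorant n α)]
  simp only [finrank_euclideanSpace, Fintype.card_fin, smul_eq_mul]
  have hIoo : IntegrableOn (fun r : ℝ => r ^ (n - 1) * radialMajorant n α r)
      (Set.Ioo 0 (1 / 2)) := by
    refine ((intervalIntegral.integrableOn_Ioo_rpow_iff (s := -α) (t := 1 / 2)
      (by norm_num)).mpr (by linarith)).congr_fun (fun r hr => ?_) measurableSet_Ioo
    have hr0 : 0 < r := hr.1
    have e := pow_sub_one_mul_rpow_neg hn hr0 α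
    simp only [radialMajorant, if_pos hr.2]
    rw [div_eq_mul_one_div, mul_left_comm, e, ← Real.rpow_one_add' hr0.le (by linarith)]
    congr 1
    ring
  have hIci : IntegrableOn (fun r : ℝ => r ^ (n - 1) * radialMajorant n α r)
      (Set.Ici (1 / 2)) := by
    rw [integrableOn_Ici_iff_integrableOn_Ioi]
    refine (integrableOn_Ioi_rpow_of_lt (a := -1 - α) (c := 1 / 2) (by linarith)
      (by norm_num)).congr_fun (fun r hr => ?_) measurableSet_Ioi
    have hr' : 1 / 2 < r := hr
    have hr0 : 0 < r := by linarith
    simp only [radialMajorant, if_neg hr'.not_gt]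
    rw [pow_sub_one_mul_rpow_neg hn hr0]
  rw [← Set.Ioo_union_Ici_eq_Ioi (by norm_num : (0 : ℝ) < 1 / 2)]
  exact hIoo.union hIci

lemma exists_fracLap_poissonKer_unit_bound {n : ℕ} (hn : 0 < n) {α : ℝ} (h0 : 0 < α)
    (h1 : α < 1) :
    ∃ C : ℝ, 0 < C ∧ ∀ s : ℝ, 0 < s → ∀ w : EuclideanSpace ℝ (Fin n),
      s ^ 2 + ‖w‖ ^ 2 = 1 → |fracLap α (poissonKer n s) w| ≤ C := by
  set L : ℝ := 3 * ((((n : ℝ) + 1) / 2) * (1 / 4) ^ (-(((n : ℝ) + 1) / 2) - 1)) with hL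
  have hL0 : 0 < L := by positivity
  set B : ℝ := ((1 / 2 : ℝ) ^ ((n : ℝ) + α))⁻¹ with hB
  have hB0 : 0 < B := by positivity
  set I := ∫ u : EuclideanSpace ℝ (Fin n), radialMajorant n α ‖u‖ with hI
  set J := ∫ x : EuclideanSpace ℝ (Fin n), poissonKer n 1 x with hJ
  have hI0 : 0 ≤ I := integral_nonneg fun u => radialMajorant_nonneg n α (norm_nonneg u)
  have hJ0 : 0 ≤ J := integral_nonneg fun x => (poissonKer_pos one_pos x).le
  refine ⟨(L + 1) * I + B * J + 1, by positivity, fun s hs w hw => ?_⟩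
  have hg := ((integrable_radialMajorant_norm hn h0 h1).comp_sub_left w).const_mul (L + 1)
  have hp := (integrable_poissonKer (n := n) hs).const_mul B
  have hs1 : s ≤ 1 := by nlinarith [sq_nonneg ‖w‖]
  have hpw : poissonKer n s w = s := by simp [poissonKer, hw]
  have hbound : ∀ y, ‖(poissonKer n s w - poissonKer n s y) / ‖w - y‖ ^ ((n : ℝ) + α)‖ ≤
      (L + 1) * radialMajorant n α ‖w - y‖ + B * poissonKer n s y := by
    intro y
    have hpy := (poissonKer_pos hs y).le
    have hd : 0 ≤ ‖w - y‖ ^ ((n : ℝ) + α) := by positivity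
    rw [norm_div, Real.norm_eq_abs, Real.norm_of_nonneg hd]
    by_cases hy : ‖w - y‖ < 1 / 2
    · have hm := radialMajorant_nonneg n α (norm_nonneg (w - y))
      have key : |poissonKer n s w - poissonKer n s y| / ‖w - y‖ ^ ((n : ℝ) + α) ≤
          L * radialMajorant n α ‖w - y‖ := by
        rw [radialMajorant, if_pos hy, ← mul_div_assoc]
        exact div_le_div_of_nonneg_right (abs_poissonKer_sub_le hs hw hy) hd
      nlinarith [mul_nonneg hB0.le hpy]
    · have hy' := not_lt.mp hy
      have hinv : 1 / ‖w - y‖ ^ ((n : ℝ) + α) ≤ B := by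
        rw [hB, one_div]
        exact inv_anti₀ (by positivity)
          (Real.rpow_le_rpow (by norm_num) hy' (by positivity))
      have hi0 : 0 ≤ 1 / ‖w - y‖ ^ ((n : ℝ) + α) := by positivity
      have habs : |poissonKer n s w - poissonKer n s y| ≤ 1 + poissonKer n s y := by
        rw [hpw, abs_le]
        constructor <;> linarith
      rw [radialMajorant, if_neg hy, div_eq_mul_one_div]
      have k1 := mul_le_mul_of_nonneg_right habs hi0
      have k2 := mul_le_mul_of_nonneg_left hinv hpy
      nlinarith [mul_nonneg hL0.le hi0]
  have h := norm_integral_le_of_norm_le (hg.add hp) (ae_of_all volume hbound)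
  simp only [Pi.add_apply] at h
  rw [integral_add hg hp, integral_const_mul, integral_const_mul, integral_poissonKer hs,
    integral_sub_left_eq_self (fun u => radialMajorant n α ‖u‖) volume w] at h
  rw [Real.norm_eq_abs] at h
  exact h.trans (by linarith)

lemma not_integrable_norm_rpow_neg_dim {n : ℕ} (hn : 0 < n) {M : ℝ} (hM : 0 < M) :
    ¬ Integrable (fun u : EuclideanSpace ℝ (Fin n) =>
      (Set.Ioi M).indicator (fun r : ℝ => 1 / r ^ (n : ℝ)) ‖u‖) := by
  have : Nonempty (Fin n) := ⟨⟨0, hn⟩⟩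
  rw [integrable_fun_norm_addHaar volume (f := (Set.Ioi M).indicator fun r : ℝ => 1 / r ^ (n : ℝ))]
  simp only [finrank_euclideanSpace, Fintype.card_fin, smul_eq_mul]
  intro h
  have h' : IntegrableOn (fun r : ℝ => r ^ (-1 : ℝ)) (Set.Ioi M) := by
    refine (h.mono_set (Set.Ioi_subset_Ioi hM.le)).congr_fun (fun r hr => ?_) measurableSet_Ioi
    have e := pow_sub_one_mul_rpow_neg hn (hM.trans hr) 0
    simp only [Set.indicator_of_mem hr]
    simpa using e
  exact lt_irrefl _ ((integrableOn_Ioi_rpow_iff hM).mp h')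

lemma poissonKer_le_half {n : ℕ} {t : ℝ} (ht : 0 < t) {z y : EuclideanSpace ℝ (Fin n)}
    (h : 3 * (t + ‖z‖) < ‖z - y‖) : poissonKer n t y ≤ poissonKer n t z / 2 := by
  have hz := norm_nonneg z
  have hy : 2 * (t + ‖z‖) ≤ ‖y‖ := by linarith [norm_sub_le z y]
  have hm : (0 : ℝ) ≤ ((n : ℝ) + 1) / 2 := by positivity
  have hq : 4 * (t ^ 2 + ‖z‖ ^ 2) ≤ t ^ 2 + ‖y‖ ^ 2 := by
    nlinarith [mul_nonneg ht.le hz, sq_nonneg t]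
  have h2 : (2 : ℝ) ≤ 4 ^ (((n : ℝ) + 1) / 2) := by
    calc (2 : ℝ) = (2 ^ (2 : ℝ)) ^ (1 / 2 : ℝ) := by
          rw [← Real.rpow_mul (by norm_num)]; norm_num
      _ = 4 ^ (1 / 2 : ℝ) := by norm_num
      _ ≤ 4 ^ (((n : ℝ) + 1) / 2) := Real.rpow_le_rpow_of_exponent_le (by norm_num) (by
          linarith [Nat.cast_nonneg (α := ℝ) n])
  have hpow := Real.rpow_le_rpow (by positivity) hq hm
  rw [Real.mul_rpow (by norm_num) (by positivity)] at hpow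
  have hzq : 0 < (t ^ 2 + ‖z‖ ^ 2) ^ (((n : ℝ) + 1) / 2) := by positivity
  unfold poissonKer
  rw [div_div]
  exact div_le_div_of_nonneg_left ht.le (by positivity) (by nlinarith)

lemma fracLap_zero_poissonKer {n : ℕ} (hn : 0 < n) {t : ℝ} (ht : 0 < t)
    (z : EuclideanSpace ℝ (Fin n)) : fracLap 0 (poissonKer n t) z = 0 := by
  refine integral_undef fun hint => ?_
  have hM : 0 < 3 * (t + ‖z‖) := by positivity
  have hpz := poissonKer_pos ht z
  have hint' := (hint.comp_sub_left z).norm.const_mul (2 / poissonKer n t z)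
  simp only [sub_sub_cancel, add_zero] at hint'
  refine not_integrable_norm_rpow_neg_dim hn hM (hint'.mono' ?_ (ae_of_all _ fun u => ?_))
  · exact ((measurable_const.div (measurable_id.pow_const _)).indicator
      measurableSet_Ioi).comp measurable_norm |>.aestronglyMeasurable
  · by_cases hu : u ∈ norm ⁻¹' Set.Ioi (3 * (t + ‖z‖))
    · have hu' : 3 * (t + ‖z‖) < ‖u‖ := hu
      have hhalf : poissonKer n t (z - u) ≤ poissonKer n t z / 2 :=
        poissonKer_le_half ht (by simpa using hu')
      have hd : 0 ≤ ‖u‖ ^ (n : ℝ) := by positivity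
      rw [Set.indicator_of_mem (show ‖u‖ ∈ Set.Ioi (3 * (t + ‖z‖)) from hu),
        Real.norm_of_nonneg (by positivity),
        norm_div, Real.norm_of_nonneg hd, ← mul_div_assoc]
      refine div_le_div_of_nonneg_right ?_ hd
      rw [div_mul_eq_mul_div, one_le_div hpz]
      linarith [Real.le_norm_self (poissonKer n t z - poissonKer n t (z - u))]
    · rw [Set.indicator_of_notMem (show ‖u‖ ∉ Set.Ioi (3 * (t + ‖z‖)) from hu), norm_zero]
      positivity

/-- For `α ∈ [0,1)`, `t > 0` and `z ∈ ℝⁿ`: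
`|(−Δ)^{α/2} p_t(z)| ≲ (t² + |z|²)^{−(n+α)/2}`, uniformly in `t` and `z`. -/
theorem fracLap_poisson_bound (n : ℕ) (α : ℝ) (hα : α ∈ Set.Ico (0:ℝ) 1) :
    ∃ C : ℝ, 0 < C ∧
      ∀ t : ℝ, 0 < t → ∀ z : EuclideanSpace ℝ (Fin n),
        |fracLap α (poissonKer n t) z| ≤ C * (t ^ 2 + ‖z‖ ^ 2) ^ (-((n : ℝ) + α) / 2) := by
  obtain ⟨h0, h1⟩ := hα
  rcases Nat.eq_zero_or_pos n with rfl | hn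
  · refine ⟨1, one_pos, fun t ht z => ?_⟩
    have : fracLap α (poissonKer 0 t) z = 0 := by
      simp [fracLap, Subsingleton.elim _ z]
    rw [this, abs_zero]
    positivity
  rcases h0.eq_or_lt with rfl | hpos
  · refine ⟨1, one_pos, fun t ht z => ?_⟩
    rw [fracLap_zero_poissonKer hn ht, abs_zero]
    positivity
  obtain ⟨C, hC, hbound⟩ := exists_fracLap_poissonKer_unit_bound hn hpos h1
  refine ⟨C, hC, fun t ht z => ?_⟩
  have hq : 0 < t ^ 2 + ‖z‖ ^ 2 := by positivity
  set R := √(t ^ 2 + ‖z‖ ^ 2) with hR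
  have hR0 : 0 < R := Real.sqrt_pos.mpr hq
  have hR2 : R ^ 2 = t ^ 2 + ‖z‖ ^ 2 := Real.sq_sqrt hq.le
  have hunit : (t / R) ^ 2 + ‖R⁻¹ • z‖ ^ 2 = 1 := by
    rw [norm_smul, norm_inv, Real.norm_of_nonneg hR0.le]
    field_simp
    linarith
  have hs : 0 < t / R := by positivity
  have hscale := fracLap_poissonKer_mul_smul α hR0 hs (R⁻¹ • z)
  rw [mul_div_cancel₀ t hR0.ne', smul_inv_smul₀ hR0.ne'] at hscale
  have hpow : R ^ (-((n : ℝ) + α)) = (t ^ 2 + ‖z‖ ^ 2) ^ (-((n : ℝ) + α) / 2) := by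
    rw [← hR2, ← Real.rpow_natCast R 2, ← Real.rpow_mul hR0.le]
    congr 1
    push_cast
    ring
  rw [hscale, hpow, abs_mul, abs_of_nonneg (by positivity), mul_comm]
  exact mul_le_mul_of_nonneg_right (hbound _ hs _ hunit) (by positivity)
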